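/- Let N > 1 be an integer and k > 1/2 real. Then the double series over zeros can be exchanged with the integral and (1/(4√π·i))·∫_{(1/N)} e^{Nz}·z^{−k−3/2}·(∑_{ρ₁} z^{−ρ₁}Γ(ρ₁))·(∑_{ρ₂} z^{−ρ₂/2}Γ(ρ₂/2)) dz = (N^{k+1/2}√π/2)·∑_{ρ₁}∑_{ρ₂} N^{ρ₁+ρ₂/2}·Γ(ρ₁)Γ(ρ₂/2)/Γ(k+3/2+ρ₁+ρ₂/2), where ρ₁, ρ₂ run over the non-trivial zeros of the Riemann zeta function and ∫_{(1/N)} denotes the integral over the vertical line Re(z) = 1/N. -/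

import Mathlib

open Complex

noncomputable section

/-- The non-trivial zeros of the Riemann zeta function. -/
def zetaZeros : Set ℂ := {ρ | riemannZeta ρ = 0 ∧ 0 < ρ.re ∧ ρ.re < 1}

/-- The functions `x ↦ x ^ 2 / (x ^ 2 + t ^ 2)` are logarithmically concave on `(0, ∞)`. -/
theorem sq_div_sq_add_sq_logConcave {a b l m : ℝ} (t : ℝ) (ha : 0 < a) (hb : 0 < b)
    (hl : 0 ≤ l) (hm : 0 ≤ m) (hlm : l + m = 1) :
    (a ^ 2 / (a ^ 2 + t ^ 2)) ^ l * (b ^ 2 / (b ^ 2 + t ^ 2)) ^ m ≤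
      (l * a + m * b) ^ 2 / ((l * a + m * b) ^ 2 + t ^ 2) := by
  have hx : 0 < l * a + m * b := by
    rcases hl.eq_or_lt with rfl | hl
    · have : m = 1 := by linarith
      simp [this, hb]
    · positivity
  have hA : 0 < a ^ 2 + t ^ 2 := by positivity
  have hB : 0 < b ^ 2 + t ^ 2 := by positivity
  have h1 := Real.geom_mean_le_arith_mean2_weighted hl hm
    (by positivity : 0 ≤ a ^ 2 / (a ^ 2 + t ^ 2)) (by positivity : 0 ≤ b ^ 2 / (b ^ 2 + t ^ 2)) hlm
  have h2 := Real.geom_mean_le_arith_mean2_weighted hl hm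
    (by positivity : 0 ≤ t ^ 2 / (a ^ 2 + t ^ 2)) (by positivity : 0 ≤ t ^ 2 / (b ^ 2 + t ^ 2)) hlm
  have h3 := Real.geom_mean_le_arith_mean2_weighted hl hm ha.le hb.le hlm
  have e1 : a ^ 2 / (a ^ 2 + t ^ 2) = 1 - t ^ 2 / (a ^ 2 + t ^ 2) := by field_simp; ring
  have e2 : b ^ 2 / (b ^ 2 + t ^ 2) = 1 - t ^ 2 / (b ^ 2 + t ^ 2) := by field_simp; ring
  set P := (a ^ 2 / (a ^ 2 + t ^ 2)) ^ l * (b ^ 2 / (b ^ 2 + t ^ 2)) ^ m with hP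
  set Q := (t ^ 2 / (a ^ 2 + t ^ 2)) ^ l * (t ^ 2 / (b ^ 2 + t ^ 2)) ^ m with hQ
  have hP0 : 0 ≤ P := by positivity
  have hPQ : P + Q ≤ 1 := by
    rw [e1, e2] at h1
    nlinarith [h1, h2]
  have hrel : P * t ^ 2 = Q * (a ^ l * b ^ m) ^ 2 := by
    have ht : (t ^ 2) ^ l * (t ^ 2) ^ m = t ^ 2 := by
      rw [← Real.rpow_add' (by positivity) (by rw [hlm]; norm_num), hlm, Real.rpow_one]
    have hab : (a ^ l * b ^ m) ^ 2 = (a ^ 2) ^ l * (b ^ 2) ^ m := by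
      rw [mul_pow, ← Real.rpow_natCast, ← Real.rpow_natCast, ← Real.rpow_natCast,
        ← Real.rpow_natCast, ← Real.rpow_mul ha.le, ← Real.rpow_mul hb.le, ← Real.rpow_mul ha.le,
        ← Real.rpow_mul hb.le, mul_comm l, mul_comm m]
    rw [hP, hQ, hab, Real.div_rpow (by positivity) hA.le, Real.div_rpow (by positivity) hB.le,
      Real.div_rpow (by positivity) hA.le, Real.div_rpow (by positivity) hB.le]
    calc _ = (a ^ 2) ^ l * (b ^ 2) ^ m / ((a ^ 2 + t ^ 2) ^ l * (b ^ 2 + t ^ 2) ^ m) * t ^ 2 := by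
          ring
      _ = (a ^ 2) ^ l * (b ^ 2) ^ m / ((a ^ 2 + t ^ 2) ^ l * (b ^ 2 + t ^ 2) ^ m) *
            ((t ^ 2) ^ l * (t ^ 2) ^ m) := by rw [ht]
      _ = _ := by ring
  have hg : (a ^ l * b ^ m) ^ 2 ≤ (l * a + m * b) ^ 2 := by gcongr
  have hQ0 : 0 ≤ Q := by positivity
  rw [le_div_iff₀ (by positivity)]
  nlinarith [mul_le_mul_of_nonneg_left hg hQ0, mul_le_mul_of_nonneg_right hPQ (sq_nonneg (l*a+m*b))]

theorem norm_GammaSeq_sq_div (x t : ℝ) (hx : 0 < x) {n : ℕ} (hn : n ≠ 0) :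
    (‖Complex.GammaSeq (x + t * I) n‖ / Real.GammaSeq x n) ^ 2 =
      ∏ j ∈ Finset.range (n + 1), ((x + j) ^ 2 / ((x + j) ^ 2 + t ^ 2)) := by
  have hn' : (0 : ℝ) < n := by positivity
  have h1 : ‖(n : ℂ) ^ ((x : ℂ) + t * I)‖ = (n : ℝ) ^ x := by
    rw [Complex.norm_natCast_cpow_of_pos (by omega)]
    simp
  have h2 : ∀ j : ℕ, ‖(x : ℂ) + t * I + j‖ ^ 2 = (x + j) ^ 2 + t ^ 2 := by
    intro j
    have : (x : ℂ) + t * I + j = ((x + j : ℝ) : ℂ) + (t : ℝ) * I := by push_cast; ring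
    rw [this, Complex.sq_norm, Complex.normSq_add_mul_I]
  have h4 : (n : ℝ) ^ x ≠ 0 := by positivity
  have h5 : (n.factorial : ℝ) ≠ 0 := by positivity
  have h6 : ∏ j ∈ Finset.range (n + 1), (x + j) ≠ 0 :=
    Finset.prod_ne_zero_iff.2 fun j _ => by positivity
  have h7 : ∏ j ∈ Finset.range (n + 1), ‖(x : ℂ) + t * I + j‖ ≠ 0 := by
    refine Finset.prod_ne_zero_iff.2 fun j _ => ?_
    have := h2 j
    have : 0 < ‖(x : ℂ) + t * I + j‖ ^ 2 := by rw [this]; positivity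
    exact fun h => by simp [h] at this
  have h3 : ‖Complex.GammaSeq (x + t * I) n‖ / Real.GammaSeq x n =
      (∏ j ∈ Finset.range (n + 1), (x + j)) / ∏ j ∈ Finset.range (n + 1), ‖(x : ℂ) + t * I + j‖ := by
    rw [Complex.GammaSeq, Real.GammaSeq, norm_div, norm_mul, h1, norm_prod, Complex.norm_natCast]
    field_simp
  rw [h3, div_pow, ← Finset.prod_pow, ← Finset.prod_pow, ← Finset.prod_div_distrib]
  exact Finset.prod_congr rfl fun j _ => by rw [h2]

/-- For fixed `t`, the function `x ↦ ‖Γ(x + it)‖ / Γ(x)` is logarithmically concave. -/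
theorem norm_Gamma_div_Gamma_logConcave {a b l m : ℝ} (t : ℝ) (ha : 0 < a) (hb : 0 < b)
    (hl : 0 ≤ l) (hm : 0 ≤ m) (hlm : l + m = 1) :
    (‖Complex.Gamma (a + t * I)‖ / Real.Gamma a) ^ l *
      (‖Complex.Gamma (b + t * I)‖ / Real.Gamma b) ^ m ≤
      ‖Complex.Gamma ((l * a + m * b : ℝ) + t * I)‖ / Real.Gamma (l * a + m * b) := by
  have hx : 0 < l * a + m * b := by
    rcases hl.eq_or_lt with rfl | hl
    · have : m = 1 := by linarith
      simp [this, hb]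
    · positivity
  have hlim : ∀ x : ℝ, 0 < x → Filter.Tendsto
      (fun n => (‖Complex.GammaSeq (x + t * I) n‖ / Real.GammaSeq x n)) Filter.atTop
      (nhds (‖Complex.Gamma (x + t * I)‖ / Real.Gamma x)) := fun x hx =>
    (Complex.GammaSeq_tendsto_Gamma _).norm.div (Real.GammaSeq_tendsto_Gamma x)
      (Real.Gamma_pos_of_pos hx).ne'
  refine le_of_tendsto_of_tendsto (((hlim a ha).rpow_const (Or.inr hl)).mul
    ((hlim b hb).rpow_const (Or.inr hm))) (hlim _ hx) ?_
  filter_upwards [Filter.eventually_ne_atTop 0] with n hn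
  have hpos : ∀ x : ℝ, 0 < x → 0 ≤ ‖Complex.GammaSeq (x + t * I) n‖ / Real.GammaSeq x n := by
    intro x hx
    refine div_nonneg (norm_nonneg _) ?_
    rw [Real.GammaSeq]
    exact div_nonneg (by positivity) (Finset.prod_nonneg fun j _ => by positivity)
  refine le_of_sq_le_sq ?_ (hpos _ hx)
  have hsw : ∀ (u r : ℝ), 0 ≤ u → (u ^ r) ^ 2 = (u ^ 2) ^ r := by
    intro u r hu
    rw [← Real.rpow_natCast, ← Real.rpow_natCast, ← Real.rpow_mul hu, ← Real.rpow_mul hu, mul_comm]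
  rw [mul_pow, hsw _ _ (hpos a ha), hsw _ _ (hpos b hb), norm_GammaSeq_sq_div a t ha hn,
    norm_GammaSeq_sq_div b t hb hn, norm_GammaSeq_sq_div _ t hx hn,
    ← Real.finsetProd_rpow _ _ (fun j _ => by positivity),
    ← Real.finsetProd_rpow _ _ (fun j _ => by positivity), ← Finset.prod_mul_distrib]
  refine Finset.prod_le_prod (fun j _ => by positivity) fun j _ => ?_
  have := sq_div_sq_add_sq_logConcave t (by positivity : 0 < a + j) (by positivity : 0 < b + j)
    hl hm hlm
  have e : l * (a + j) + m * (b + j) = l * a + m * b + j := by linear_combination (j : ℝ) * hlm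
  rwa [e] at this

theorem div_sinh_le {x : ℝ} (hx : 0 < x) : x / Real.sinh x ≤ 2 * (1 + x) * Real.exp (-x) := by
  rw [div_le_iff₀ (Real.sinh_pos_iff.2 hx), Real.sinh_eq]
  have h1 : Real.exp (-x) * Real.exp x = 1 := by rw [← Real.exp_add]; simp
  have h2 : (1 + x) * Real.exp (-x) ≤ 1 := by
    calc (1 + x) * Real.exp (-x) ≤ Real.exp x * Real.exp (-x) := by
          gcongr; linarith [Real.add_one_le_exp x]
      _ = 1 := by rw [mul_comm, h1]
  have h3 : Real.exp (-x) ≤ 1 := Real.exp_le_one_iff.2 (by linarith)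
  have h4 : 0 < Real.exp (-x) := Real.exp_pos _
  nlinarith [mul_le_mul h2 h3 h4.le zero_le_one]

theorem mul_cosh_le {x : ℝ} (hx : 0 < x) : x * Real.cosh x ≤ (1 + x) * Real.sinh x := by
  rw [Real.sinh_eq, Real.cosh_eq]
  have h1 : Real.exp (-x) * Real.exp x = 1 := by rw [← Real.exp_add]; simp
  have h2 := Real.add_one_le_exp x
  have h3 : 0 < Real.exp (-x) := Real.exp_pos _
  have h4 : Real.exp (-x) ≤ 1 := Real.exp_le_one_iff.2 (by linarith)
  have h5 : x * Real.exp (-x) ≤ Real.exp x - 1 := by nlinarith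
  nlinarith

theorem norm_Gamma_one_add_sq {t : ℝ} (ht : 0 < t) :
    ‖Complex.Gamma (1 + t * I)‖ ^ 2 = Real.pi * t / Real.sinh (Real.pi * t) := by
  have h0 : (t : ℂ) * I ≠ 0 := by simp [ht.ne']
  have hc : (starRingEnd ℂ) (1 + t * I) = 1 - t * I := by simp; ring
  have h1 := Complex.Gamma_mul_Gamma_one_sub (t * I)
  have h2 : Complex.Gamma (1 + t * I) * Complex.Gamma (1 - t * I) =
      ((Real.pi * t / Real.sinh (Real.pi * t) : ℝ) : ℂ) := by
    rw [add_comm 1, Complex.Gamma_add_one _ h0, mul_assoc, h1, ← mul_assoc, Complex.sin_mul_I]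
    have : Complex.sinh (Real.pi * t) ≠ 0 := by
      have := (Real.sinh_pos_iff.2 (by positivity : 0 < Real.pi * t)).ne'
      exact_mod_cast this
    push_cast
    field_simp
  rw [← hc, Complex.Gamma_conj, Complex.mul_conj] at h2
  rw [Complex.sq_norm]
  exact_mod_cast h2

theorem norm_Gamma_half_add_sq (t : ℝ) :
    ‖Complex.Gamma (1 / 2 + t * I)‖ ^ 2 = Real.pi / Real.cosh (Real.pi * t) := by
  have hc : (starRingEnd ℂ) (1 / 2 + t * I) = 1 - (1 / 2 + t * I) := by
    simp [map_ofNat]; ring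
  have h1 := Complex.Gamma_mul_Gamma_one_sub (1 / 2 + t * I)
  have h2 : Complex.Gamma (1 / 2 + t * I) * Complex.Gamma (1 - (1 / 2 + t * I)) =
      ((Real.pi / Real.cosh (Real.pi * t) : ℝ) : ℂ) := by
    have e : (Real.pi : ℂ) * (1 / 2 + t * I) = (Real.pi * t) * I + Real.pi / 2 := by ring
    rw [h1, e, Complex.sin_add_pi_div_two, Complex.cos_mul_I]
    push_cast
    rfl
  rw [← hc, Complex.Gamma_conj, Complex.mul_conj] at h2
  rw [Complex.sq_norm]
  exact_mod_cast h2

theorem norm_Gamma_two_add_le {t : ℝ} (ht : 0 < t) :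
    ‖Complex.Gamma (2 + t * I)‖ ≤
      8 * (1 + t) ^ (3 / 2 : ℝ) * Real.exp (-(Real.pi * t / 2)) := by
  have h1 : (1 : ℂ) + t * I ≠ 0 := by
    intro h; simpa using congrArg Complex.re h
  have e : (2 : ℂ) + t * I = (1 + t * I) + 1 := by ring
  have h3 : ‖(1 : ℂ) + t * I‖ ^ 2 = 1 + t ^ 2 := by
    have : (1 : ℂ) + t * I = ((1 : ℝ) : ℂ) + (t : ℝ) * I := by push_cast; ring
    rw [this, Complex.sq_norm, Complex.normSq_add_mul_I]; ring
  refine le_of_sq_le_sq ?_ (by positivity)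
  have h4 := div_sinh_le (by positivity : 0 < Real.pi * t)
  have h5 : Real.exp (-(Real.pi * t / 2)) ^ 2 = Real.exp (-(Real.pi * t)) := by
    rw [← Real.exp_nat_mul]; congr 1; push_cast; ring
  have h6 : ((1 + t) ^ (3 / 2 : ℝ)) ^ 2 = (1 + t) ^ 3 := by
    rw [← Real.rpow_natCast, ← Real.rpow_mul (by positivity)]; norm_num
  rw [e, Complex.Gamma_add_one _ h1, norm_mul, mul_pow, h3, norm_Gamma_one_add_sq ht, mul_pow,
    mul_pow, h5, h6]
  have h7 : 1 + Real.pi * t ≤ 4 * (1 + t) := by nlinarith [Real.pi_le_four]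
  calc (1 + t ^ 2) * (Real.pi * t / Real.sinh (Real.pi * t))
      ≤ (1 + t) ^ 2 * (2 * (4 * (1 + t)) * Real.exp (-(Real.pi * t))) := by
        refine mul_le_mul (by nlinarith) (h4.trans ?_) ?_ (by positivity)
        · gcongr
        · have := Real.sinh_pos_iff.2 (by positivity : 0 < Real.pi * t)
          positivity
    _ ≤ _ := by nlinarith [mul_pos (pow_pos (by positivity : 0 < 1 + t) 3)
                 (Real.exp_pos (-(Real.pi * t)))]

theorem norm_Gamma_two_add_le_mul {t : ℝ} (ht : 0 < t) :
    ‖Complex.Gamma (2 + t * I)‖ ≤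
      4 * (1 + t) ^ (-1 / 2 : ℝ) * ‖Complex.Gamma (5 / 2 + t * I)‖ := by
  have h1 : (1 : ℂ) + t * I ≠ 0 := by
    intro h; simpa using congrArg Complex.re h
  have h1' : (1 / 2 : ℂ) + t * I ≠ 0 := by
    intro h; simpa using congrArg Complex.re h
  have h1'' : (3 / 2 : ℂ) + t * I ≠ 0 := by
    intro h; simpa using congrArg Complex.re h
  have e : (2 : ℂ) + t * I = (1 + t * I) + 1 := by ring
  have e' : (5 / 2 : ℂ) + t * I = (3 / 2 + t * I) + 1 := by ring
  have e'' : (3 / 2 : ℂ) + t * I = (1 / 2 + t * I) + 1 := by ring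
  have hn (r : ℝ) : ‖(r : ℂ) + t * I‖ ^ 2 = r ^ 2 + t ^ 2 := by
    rw [Complex.sq_norm, Complex.normSq_add_mul_I]
  have n1 : ‖(1 : ℂ) + t * I‖ ^ 2 = 1 + t ^ 2 := by simpa using hn 1
  have n2 : ‖(1 / 2 : ℂ) + t * I‖ ^ 2 = (1 / 2) ^ 2 + t ^ 2 := by simpa using hn (1 / 2)
  have n3 : ‖(3 / 2 : ℂ) + t * I‖ ^ 2 = (3 / 2) ^ 2 + t ^ 2 := by
    have := hn (3 / 2)
    push_cast at this
    exact this
  refine le_of_sq_le_sq ?_ (by positivity)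
  have h6 : ((1 + t) ^ (-1 / 2 : ℝ)) ^ 2 = (1 + t)⁻¹ := by
    rw [← Real.rpow_natCast, ← Real.rpow_mul (by positivity)]; norm_num
    rw [Real.rpow_neg_one]
  have hs := Real.sinh_pos_iff.2 (by positivity : 0 < Real.pi * t)
  have hc := Real.cosh_pos (Real.pi * t)
  have key := mul_cosh_le (by positivity : 0 < Real.pi * t)
  rw [e', Complex.Gamma_add_one _ h1'', e'', Complex.Gamma_add_one _ h1', ← e'', e,
    Complex.Gamma_add_one _ h1]
  simp only [norm_mul, mul_pow]
  rw [n1, n2, n3, h6, norm_Gamma_one_add_sq ht, norm_Gamma_half_add_sq]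
  have hpi := Real.pi_gt_three
  calc (1 + t ^ 2) * (Real.pi * t / Real.sinh (Real.pi * t))
      ≤ (1 + t ^ 2) * ((1 + Real.pi * t) / Real.cosh (Real.pi * t)) := by
        gcongr ?_ * ?_
        rw [div_le_div_iff₀ hs hc]
        exact key
    _ ≤ (1 + t ^ 2) * ((Real.pi * (1 + t)) / Real.cosh (Real.pi * t)) := by
        gcongr
        nlinarith
    _ = ((1 + t ^ 2) * (1 + t)) * (Real.pi / Real.cosh (Real.pi * t)) := by ring
    _ ≤ (4 ^ 2 * (1 + t)⁻¹ * (((3 / 2) ^ 2 + t ^ 2) * ((1 / 2) ^ 2 + t ^ 2))) *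
          (Real.pi / Real.cosh (Real.pi * t)) := by
        refine mul_le_mul_of_nonneg_right ?_ (by positivity)
        rw [mul_right_comm, ← div_eq_mul_inv, le_div_iff₀ (by positivity)]
        nlinarith [sq_nonneg (1 - t), sq_nonneg (t ^ 2 - t)]
    _ = _ := by ring

theorem norm_Gamma_add_one_le_of_pos {x t : ℝ} (hx0 : 0 < x) (hx1 : x < 1) (ht : 0 < t) :
    ‖Complex.Gamma ((x + 1 : ℝ) + t * I)‖ ≤ 8 * (1 + 4 * Real.Gamma (5 / 2)) ^ 2 *
      (1 + t) ^ (x + 1 / 2) * Real.exp (-(Real.pi * t / 2)) := by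
  set c := Real.Gamma (5 / 2) with hc
  have hc0 : 0 < c := Real.Gamma_pos_of_pos (by norm_num)
  have h32 : 0 < 3 - 2 * x := by linarith
  set l := 1 / (3 - 2 * x) with hl
  set m := (2 - 2 * x) / (3 - 2 * x) with hm
  have hl0 : 0 < l := by positivity
  have hm0 : 0 ≤ m := div_nonneg (by linarith) h32.le
  have hlm : l + m = 1 := by rw [hl, hm]; field_simp; ring
  have key := norm_Gamma_div_Gamma_logConcave t (by linarith : 0 < x + 1)
    (by norm_num : (0 : ℝ) < 5 / 2) hl0.le hm0 hlm
  have e2 : l * (x + 1) + m * (5 / 2) = 2 := by rw [hl, hm]; field_simp; ring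
  have hGx : Real.Gamma (x + 1) ≤ 1 := by
    have := Real.convexOn_Gamma.2 (by norm_num : (1 : ℝ) ∈ Set.Ioi 0)
      (by norm_num : (2 : ℝ) ∈ Set.Ioi 0) (by linarith : 0 ≤ 1 - x) hx0.le (by ring)
    simp only [smul_eq_mul, Real.Gamma_one, Real.Gamma_two] at this
    have e : (1 - x) * 1 + x * 2 = x + 1 := by ring
    rw [e] at this
    linarith
  have hGx0 : 0 < Real.Gamma (x + 1) := Real.Gamma_pos_of_pos (by linarith)
  rw [e2, Real.Gamma_two, div_one] at key
  have e52 : (((5 / 2 : ℝ) : ℂ)) = 5 / 2 := by push_cast; rfl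
  rw [e52, Complex.ofReal_ofNat, ← hc] at key
  have hq := norm_Gamma_two_add_le_mul ht
  have hA := norm_Gamma_two_add_le ht
  set H := ‖Complex.Gamma ((x + 1 : ℝ) + t * I)‖ with hH
  set A := ‖Complex.Gamma (2 + t * I)‖ with hAdef
  have hA0 : 0 < A := norm_pos_iff.2 (Complex.Gamma_ne_zero_of_re_pos (by simp))
  set q := 4 * c * (1 + t) ^ (-1 / 2 : ℝ) with hqdef
  have hq0 : 0 < q := by positivity
  have h1 : A / q ≤ ‖Complex.Gamma (5 / 2 + t * I)‖ / c := by
    rw [div_le_div_iff₀ hq0 hc0, hqdef]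
    nlinarith
  have h2 : (H / Real.Gamma (x + 1)) ^ l * (A / q) ^ m ≤ A :=
    le_trans (by gcongr) key
  have h3 : (H / Real.Gamma (x + 1)) ^ l ≤ (A * q ^ (2 - 2 * x)) ^ l := by
    have e : (A * q ^ (2 - 2 * x)) ^ l = A / (A / q) ^ m := by
      rw [Real.mul_rpow hA0.le (by positivity), ← Real.rpow_mul hq0.le,
        Real.div_rpow hA0.le hq0.le, div_div_eq_mul_div, mul_comm A, mul_div_assoc]
      have e3 : (2 - 2 * x) * l = m := by rw [hl, hm]; ring
      have e4 : A ^ l = A / A ^ m := by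
        rw [eq_div_iff (by positivity), ← Real.rpow_add hA0, hlm, Real.rpow_one]
      rw [e3, e4, mul_comm]
    rw [e, le_div_iff₀ (by positivity)]
    exact h2
  have h4 : H / Real.Gamma (x + 1) ≤ A * q ^ (2 - 2 * x) :=
    (Real.rpow_le_rpow_iff (by positivity) (by positivity) hl0).1 h3
  have h5 : H ≤ A * q ^ (2 - 2 * x) := by
    rw [div_le_iff₀ hGx0] at h4
    exact h4.trans (mul_le_of_le_one_right (by positivity) hGx)
  have h6 : (4 * c) ^ (2 - 2 * x) ≤ (1 + 4 * c) ^ 2 := by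
    calc (4 * c) ^ (2 - 2 * x) ≤ (1 + 4 * c) ^ (2 - 2 * x) :=
          Real.rpow_le_rpow (by positivity) (by linarith) (by linarith)
      _ ≤ (1 + 4 * c) ^ (2 : ℝ) := Real.rpow_le_rpow_of_exponent_le (by linarith) (by linarith)
      _ = _ := by norm_num
  calc H ≤ A * q ^ (2 - 2 * x) := h5
    _ = A * ((4 * c) ^ (2 - 2 * x) * (1 + t) ^ (x - 1)) := by
        rw [hqdef, Real.mul_rpow (by positivity) (by positivity), ← Real.rpow_mul (by positivity)]
        congr 3; ring
    _ ≤ (8 * (1 + t) ^ (3 / 2 : ℝ) * Real.exp (-(Real.pi * t / 2))) *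
          ((1 + 4 * c) ^ 2 * (1 + t) ^ (x - 1)) := by gcongr
    _ = _ := by
        have : (1 + t) ^ (x + 1 / 2) = (1 + t) ^ (3 / 2 : ℝ) * (1 + t) ^ (x - 1) := by
          rw [← Real.rpow_add (by positivity)]; congr 1; ring
        rw [this]; ring

theorem norm_Gamma_add_one_le {s : ℂ} (hx0 : 0 < s.re) (hx1 : s.re < 1) :
    ‖Complex.Gamma (s + 1)‖ ≤ 8 * (1 + 4 * Real.Gamma (5 / 2)) ^ 2 *
      (1 + |s.im|) ^ (s.re + 1 / 2) * Real.exp (-(Real.pi * |s.im| / 2)) := by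
  have hc0 : 0 < Real.Gamma (5 / 2) := Real.Gamma_pos_of_pos (by norm_num)
  rcases lt_trichotomy s.im 0 with h | h | h
  · have e : s + 1 = (starRingEnd ℂ) ((s.re + 1 : ℝ) + (-s.im : ℝ) * I) := by
      apply Complex.ext <;> simp
    rw [e, Complex.Gamma_conj, Complex.norm_conj, abs_of_neg h]
    exact norm_Gamma_add_one_le_of_pos hx0 hx1 (neg_pos.2 h)
  · have e : s + 1 = ((s.re + 1 : ℝ) : ℂ) := by apply Complex.ext <;> simp [h]
    have hGx : Real.Gamma (s.re + 1) ≤ 1 := by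
      have := Real.convexOn_Gamma.2 (by norm_num : (1 : ℝ) ∈ Set.Ioi 0)
        (by norm_num : (2 : ℝ) ∈ Set.Ioi 0) (by linarith : 0 ≤ 1 - s.re) hx0.le (by ring)
      simp only [smul_eq_mul, Real.Gamma_one, Real.Gamma_two] at this
      have e : (1 - s.re) * 1 + s.re * 2 = s.re + 1 := by ring
      rw [e] at this
      linarith
    rw [e, Complex.Gamma_ofReal, Complex.norm_real, Real.norm_of_nonneg
      (Real.Gamma_pos_of_pos (by linarith)).le, h]
    simp
    nlinarith
  · have e : s + 1 = (s.re + 1 : ℝ) + (s.im : ℝ) * I := by apply Complex.ext <;> simp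
    rw [e, abs_of_pos h]
    exact norm_Gamma_add_one_le_of_pos hx0 hx1 h

/-- Uniform Stirling-type upper bound for the Gamma function in the critical strip, away from the
pole at `0`. -/
theorem exists_norm_Gamma_le {d : ℝ} (hd : 0 < d) : ∃ C : ℝ, 0 < C ∧ ∀ s : ℂ, 0 < s.re →
    s.re < 1 → d ≤ ‖s‖ → ‖Complex.Gamma s‖ ≤
      C * (1 + |s.im|) ^ (s.re - 1 / 2) * Real.exp (-(Real.pi * |s.im| / 2)) := by
  have hc0 : 0 < Real.Gamma (5 / 2) := Real.Gamma_pos_of_pos (by norm_num)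
  refine ⟨(1 + d⁻¹) * (8 * (1 + 4 * Real.Gamma (5 / 2)) ^ 2), by positivity, fun s h0 h1 hs => ?_⟩
  have hs0 : s ≠ 0 := by rintro rfl; simp at h0
  have hs1 : 0 < ‖s‖ := norm_pos_iff.2 hs0
  have hG : ‖Complex.Gamma (s + 1)‖ = ‖s‖ * ‖Complex.Gamma s‖ := by
    rw [Complex.Gamma_add_one _ hs0, norm_mul]
  have hb : 1 + |s.im| ≤ (1 + d⁻¹) * ‖s‖ := by
    have h2 := Complex.abs_im_le_norm s
    have h3 : 1 ≤ d⁻¹ * ‖s‖ := by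
      rw [← div_eq_inv_mul, le_div_iff₀ hd]; linarith
    linarith
  have h4 := norm_Gamma_add_one_le h0 h1
  have e : (1 + |s.im|) ^ (s.re + 1 / 2) = (1 + |s.im|) * (1 + |s.im|) ^ (s.re - 1 / 2) := by
    rw [← Real.rpow_one_add' (by positivity) (by linarith)]; congr 1; ring
  rw [hG, e] at h4
  rw [← mul_le_mul_iff_right₀ hs1]
  refine h4.trans ?_
  calc _ = (1 + |s.im|) * (8 * (1 + 4 * Real.Gamma (5 / 2)) ^ 2 * (1 + |s.im|) ^ (s.re - 1 / 2) *
          Real.exp (-(Real.pi * |s.im| / 2))) := by ring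
    _ ≤ ((1 + d⁻¹) * ‖s‖) * (8 * (1 + 4 * Real.Gamma (5 / 2)) ^ 2 *
          (1 + |s.im|) ^ (s.re - 1 / 2) * Real.exp (-(Real.pi * |s.im| / 2))) := by gcongr
    _ = _ := by ring

theorem rpow_mul_exp_neg_le {p v : ℝ} {M : ℕ} (hp : 0 ≤ p) (hpM : p ≤ M) (hv : 0 < v) :
    v ^ p * Real.exp (-v) ≤ 1 + M.factorial := by
  have h1 : v ^ p ≤ 1 + v ^ M := by
    rcases le_total v 1 with h | h
    · have := Real.rpow_le_one hv.le h hp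
      have : 0 < v ^ M := by positivity
      linarith
    · have := Real.rpow_le_rpow_of_exponent_le h hpM
      rw [Real.rpow_natCast] at this
      linarith
  have h2 : v ^ M ≤ M.factorial * Real.exp v := by
    have := Real.pow_div_factorial_le_exp v hv.le M
    rwa [div_le_iff₀ (by positivity), mul_comm] at this
  have h3 : 1 ≤ Real.exp v := Real.one_le_exp hv.le
  rw [Real.exp_neg, ← div_eq_mul_inv, div_le_iff₀ (Real.exp_pos v)]
  nlinarith

theorem abs_im_mul_re_div_norm_le {z : ℂ} (hz : 0 < z.re) (t : ℝ) :
    |t| * (z.re / ‖z‖) ≤ Real.pi * |t| / 2 - arg z * t := by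
  have h1 : |arg z| < Real.pi / 2 := Complex.abs_arg_lt_pi_div_two_iff.2 (Or.inl hz)
  have hz0 : z ≠ 0 := by rintro rfl; simp at hz
  have h2 : z.re / ‖z‖ = Real.cos (arg z) := (Complex.cos_arg hz0).symm
  have h3 : Real.cos (arg z) ≤ Real.pi / 2 - |arg z| := by
    rw [← Real.cos_abs, ← Real.sin_pi_div_two_sub]
    exact Real.sin_le (by linarith)
  have h4 : arg z * t ≤ |arg z| * |t| := by rw [← abs_mul]; exact le_abs_self _
  rw [h2]
  nlinarith [mul_le_mul_of_nonneg_left h3 (abs_nonneg t)]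

theorem exists_norm_cpow_mul_Gamma_le {c d e : ℝ} (hc : 0 < c) (hd : 0 < d) (he : 0 < e) :
    ∃ C : ℝ, 0 < C ∧ ∀ s : ℂ, 0 < s.re → s.re < 1 → d ≤ ‖s‖ → ∀ z : ℂ, z.re = c →
      ‖z ^ (-s) * Complex.Gamma s‖ ≤ C * (1 + |s.im|) ^ (-1 - e) * ‖z‖ ^ (1 / 2 + e) := by
  obtain ⟨C, hC, hG⟩ := exists_norm_Gamma_le hd
  obtain ⟨M, hM⟩ := exists_nat_ge (3 / 2 + e)
  refine ⟨C * Real.exp 1 * (1 + M.factorial) * (1 + c⁻¹) * (c⁻¹) ^ (1 / 2 + e), by positivity,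
    fun s h0 h1 hs z hz => ?_⟩
  have hzre : 0 < z.re := hz ▸ hc
  have hz0 : z ≠ 0 := by rintro rfl; simp at hzre
  have hr : 0 < ‖z‖ := norm_pos_iff.2 hz0
  have hcr : c ≤ ‖z‖ := hz ▸ (Complex.re_le_norm z)
  set r := ‖z‖ with hrdef
  set G := 1 + |s.im| with hGdef
  have hG0 : 0 < G := by positivity
  set v := G * c / r with hv
  have hv0 : 0 < v := by positivity
  have hexp : Real.exp (arg z * s.im) * Real.exp (-(Real.pi * |s.im| / 2)) ≤
      Real.exp 1 * Real.exp (-v) := by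
    rw [← Real.exp_add, ← Real.exp_add, Real.exp_le_exp]
    have h2 := abs_im_mul_re_div_norm_le hzre s.im
    rw [hz] at h2
    have h3 : c / r ≤ 1 := (div_le_one hr).2 hcr
    have h4 : v = c / r + |s.im| * (c / r) := by rw [hv, hGdef]; ring
    rw [h4]
    linarith
  have hv1 : v ^ s.re * Real.exp (-v) ≤ (1 + M.factorial) * v ^ (-(1 / 2 + e)) := by
    have := rpow_mul_exp_neg_le (M := M) (p := s.re + (1 / 2 + e)) (by linarith) (by linarith) hv0
    rw [Real.rpow_neg hv0.le, ← div_eq_mul_inv, le_div_iff₀ (by positivity)]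
    rw [Real.rpow_add hv0] at this
    linarith
  have hcs : (c⁻¹) ^ s.re ≤ 1 + c⁻¹ := by
    have := Real.rpow_le_rpow (by positivity) (by linarith : c⁻¹ ≤ 1 + c⁻¹) h0.le
    refine this.trans ?_
    have hc1 : 1 ≤ 1 + c⁻¹ := by linarith [inv_pos.2 hc]
    simpa using Real.rpow_le_rpow_of_exponent_le hc1 h1.le
  have hrG : r ^ (-s.re) * G ^ (s.re - 1 / 2) = G ^ (-(1 / 2) : ℝ) * (v ^ s.re * (c⁻¹) ^ s.re) := by
    rw [← Real.mul_rpow hv0.le (by positivity)]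
    have : v * c⁻¹ = G / r := by rw [hv]; field_simp
    rw [this, Real.div_rpow hG0.le hr.le, Real.rpow_neg hr.le, sub_eq_add_neg, Real.rpow_add hG0]
    field_simp
  have hvr : v ^ (-(1 / 2 + e)) = G ^ (-(1 / 2 + e)) * (c⁻¹) ^ (1 / 2 + e) * r ^ (1 / 2 + e) := by
    rw [hv, Real.div_rpow (by positivity) hr.le, Real.mul_rpow hG0.le hc.le,
      Real.rpow_neg hr.le, Real.rpow_neg hc.le, Real.inv_rpow hc.le]
    field_simp
  have hGG : G ^ (-1 - e) = G ^ (-(1 / 2) : ℝ) * G ^ (-(1 / 2 + e)) := by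
    rw [← Real.rpow_add hG0]; congr 1; ring
  have hz1 : ‖z ^ (-s)‖ = r ^ (-s.re) * Real.exp (arg z * s.im) := by
    rw [Complex.norm_cpow_of_ne_zero hz0]
    simp only [Complex.neg_re, Complex.neg_im, mul_neg, Real.exp_neg, div_inv_eq_mul]
    rfl
  rw [norm_mul, hz1]
  calc r ^ (-s.re) * Real.exp (arg z * s.im) * ‖Complex.Gamma s‖
      ≤ r ^ (-s.re) * Real.exp (arg z * s.im) *
        (C * G ^ (s.re - 1 / 2) * Real.exp (-(Real.pi * |s.im| / 2))) := by
        gcongr; exact hG s h0 h1 hs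
    _ = C * (r ^ (-s.re) * G ^ (s.re - 1 / 2)) *
        (Real.exp (arg z * s.im) * Real.exp (-(Real.pi * |s.im| / 2))) := by ring
    _ ≤ C * (r ^ (-s.re) * G ^ (s.re - 1 / 2)) * (Real.exp 1 * Real.exp (-v)) := by gcongr
    _ = C * Real.exp 1 * G ^ (-(1 / 2) : ℝ) * (v ^ s.re * Real.exp (-v)) * (c⁻¹) ^ s.re := by
        rw [hrG]; ring
    _ ≤ C * Real.exp 1 * G ^ (-(1 / 2) : ℝ) * ((1 + M.factorial) * v ^ (-(1 / 2 + e))) *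
          (1 + c⁻¹) := by gcongr
    _ = _ := by rw [hvr, hGG]; ring

theorem exists_norm_f_modif_le : ∃ C p : ℝ, 0 < C ∧ 0 < p ∧ ∀ x : ℝ, 1 < x →
    ‖(HurwitzZeta.hurwitzEvenFEPair 0).f_modif x‖ ≤ C * Real.exp (-p * x) := by
  obtain ⟨p, hp, hO⟩ := HurwitzZeta.isBigO_atTop_evenKernel_sub 0
  simp only [if_true] at hO
  obtain ⟨c, hc⟩ := hO.bound
  obtain ⟨X, hX⟩ := Filter.eventually_atTop.1 hc
  have hcont : ContinuousOn (fun x : ℝ => (HurwitzZeta.evenKernel 0 x - 1) * Real.exp (p * x))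
      (Set.Icc 1 X) :=
    (((HurwitzZeta.continuousOn_evenKernel 0).mono fun x hx => lt_of_lt_of_le one_pos hx.1).sub
      continuousOn_const).mul (by fun_prop)
  obtain ⟨B, hB⟩ := isCompact_Icc.exists_bound_of_continuousOn hcont
  refine ⟨|c| + |B| + 1, p, by positivity, hp, fun x hx => ?_⟩
  have hf : (HurwitzZeta.hurwitzEvenFEPair 0).f_modif x =
      ((HurwitzZeta.evenKernel 0 x - 1 : ℝ) : ℂ) := by
    rw [WeakFEPair.f_modif, Pi.add_apply, Set.indicator_of_mem (Set.mem_Ioi.2 hx),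
      Set.indicator_of_notMem (fun h => absurd h.2 hx.le.not_gt), add_zero]
    simp [HurwitzZeta.hurwitzEvenFEPair]
  rw [hf, Complex.norm_real]
  have hE := Real.exp_pos (-p * x)
  rcases le_total X x with h | h
  · refine (hX x h).trans ?_
    rw [Real.norm_of_nonneg hE.le]
    have := le_abs_self c
    have := abs_nonneg B
    gcongr
    linarith
  · have := hB x ⟨hx.le, h⟩
    rw [norm_mul, Real.norm_of_nonneg (Real.exp_pos _).le] at this
    have e : Real.exp (p * x) * Real.exp (-p * x) = 1 := by rw [← Real.exp_add]; simp
    calc ‖HurwitzZeta.evenKernel 0 x - 1‖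
        = ‖HurwitzZeta.evenKernel 0 x - 1‖ * Real.exp (p * x) * Real.exp (-p * x) := by
          rw [mul_assoc, e, mul_one]
      _ ≤ (|c| + |B| + 1) * Real.exp (-p * x) := by
          gcongr
          linarith [le_abs_self B, abs_nonneg c]

theorem pow_mul_exp_neg_mul_le {p x : ℝ} (hp : 0 < p) (hx : 0 < x) (n : ℕ) :
    x ^ n * Real.exp (-p * x) ≤ n.factorial / p ^ n := by
  have h := Real.pow_div_factorial_le_exp (p * x) (by positivity) n
  rw [div_le_iff₀ (by positivity), mul_pow] at h
  rw [le_div_iff₀ (by positivity), neg_mul, Real.exp_neg, mul_right_comm, ← div_eq_mul_inv,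
    div_le_iff₀ (Real.exp_pos _)]
  linarith

theorem exists_norm_completedRiemannZeta₀_le : ∃ C p : ℝ, 0 < C ∧ 0 < p ∧ ∀ (n : ℕ) (s : ℂ),
    |s.re| / 2 + 1 ≤ n → ‖completedRiemannZeta₀ s‖ ≤
      C * (n.factorial / p ^ n + (n + 1).factorial / p ^ (n + 1)) := by
  obtain ⟨C, p, hC, hp, hf⟩ := exists_norm_f_modif_le
  set P := HurwitzZeta.hurwitzEvenFEPair 0 with hP
  refine ⟨Real.pi * C, p, by positivity, hp, fun n s hn => ?_⟩
  set K := C * (n.factorial / p ^ n + (n + 1).factorial / p ^ (n + 1)) with hK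
  have hK0 : 0 < K := by positivity
  have hre := abs_le.1 (le_refl |s.re|)
  have hw : (s / 2).re = s.re / 2 := by simp
  have hsymm : P.g_modif = P.f_modif := by
    change P.symm.f_modif = P.f_modif
    rw [hP, HurwitzZeta.hurwitzEvenFEPair_zero_symm]
  have hpt : ∀ x : ℝ, 0 < x → ‖(x : ℂ) ^ (s / 2 - 1) • P.f_modif x‖ ≤ 2 * K * (1 + x ^ 2)⁻¹ := by
    intro x hx
    rw [norm_smul, Complex.norm_cpow_eq_rpow_re_of_pos hx, Complex.sub_re, hw, Complex.one_re,
      ← div_eq_mul_inv]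
    rcases lt_trichotomy x 1 with h | rfl | h
    · set u := x⁻¹ with hu
      have hu1 : 1 < u := (one_lt_inv₀ hx).2 h
      have hu0 : 0 < u := by positivity
      have hxu : x = 1 / u := by rw [hu]; simp
      have h1 : x ^ (s.re / 2 - 1) ≤ u ^ n := by
        rw [hxu, one_div, Real.inv_rpow hu0.le, ← Real.rpow_neg hu0.le, ← Real.rpow_natCast]
        exact Real.rpow_le_rpow_of_exponent_le hu1.le (by linarith)
      have h2 : ‖P.f_modif x‖ ≤ u * (C * Real.exp (-p * u)) := by
        rw [hxu, P.hf_modif_FE u hu0, hsymm, norm_smul]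
        refine mul_le_mul ?_ (hf u hu1) (norm_nonneg _) hu0.le
        have e1 : P.ε = 1 := rfl
        have e2 : P.k = 1 / 2 := rfl
        rw [e1, e2, one_mul, Complex.norm_real, Real.norm_of_nonneg (by positivity)]
        simpa using Real.rpow_le_rpow_of_exponent_le hu1.le (by norm_num : (1 / 2 : ℝ) ≤ 1)
      have h3 := pow_mul_exp_neg_mul_le hp hu0 (n + 1)
      have h4 : (0 : ℝ) < n.factorial / p ^ n := by positivity
      have h5 : x ^ 2 ≤ 1 := by nlinarith
      rw [le_div_iff₀ (by positivity)]
      calc _ ≤ (u ^ n * (u * (C * Real.exp (-p * u)))) * 2 := by gcongr; linarith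
        _ = C * (u ^ (n + 1) * Real.exp (-p * u)) * 2 := by ring
        _ ≤ C * (n.factorial / p ^ n + (n + 1).factorial / p ^ (n + 1)) * 2 := by
            gcongr; linarith
        _ = 2 * K := by rw [hK]; ring
    · have : P.f_modif 1 = 0 := by simp [WeakFEPair.f_modif]
      simp [this]
      positivity
    · have h1 : x ^ (s.re / 2 - 1) ≤ x ^ n / x ^ 2 := by
        rw [le_div_iff₀ (by positivity), ← Real.rpow_natCast, ← Real.rpow_natCast,
          ← Real.rpow_add hx]
        exact Real.rpow_le_rpow_of_exponent_le h.le (by push_cast; linarith)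
      have h3 := pow_mul_exp_neg_mul_le hp hx n
      have h4 : (0 : ℝ) < (n + 1).factorial / p ^ (n + 1) := by positivity
      rw [le_div_iff₀ (by positivity)]
      calc _ ≤ (x ^ n / x ^ 2 * (C * Real.exp (-p * x))) * (2 * x ^ 2) := by
            gcongr
            · exact hf x h
            · nlinarith
        _ = C * (x ^ n * Real.exp (-p * x)) * 2 := by field_simp
        _ ≤ C * (n.factorial / p ^ n + (n + 1).factorial / p ^ (n + 1)) * 2 := by
            gcongr; linarith
        _ = 2 * K := by rw [hK]; ring
  have hint : ‖P.Λ₀ (s / 2)‖ ≤ ∫ x in Set.Ioi (0 : ℝ), 2 * K * (1 + x ^ 2)⁻¹ :=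
    MeasureTheory.norm_integral_le_of_norm_le (integrable_inv_one_add_sq.const_mul _).integrableOn
      ((MeasureTheory.ae_restrict_iff' measurableSet_Ioi).2 (Filter.Eventually.of_forall hpt))
  rw [MeasureTheory.integral_const_mul, integral_Ioi_inv_one_add_sq, Real.arctan_zero] at hint
  have e : completedRiemannZeta₀ s = P.Λ₀ (s / 2) / 2 := rfl
  rw [e, norm_div, Complex.norm_ofNat]
  have h0 : 0 ≤ ‖P.Λ₀ (s / 2)‖ := norm_nonneg _
  calc ‖P.Λ₀ (s / 2)‖ / 2 ≤ ‖P.Λ₀ (s / 2)‖ := by linarith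
    _ ≤ _ := hint
    _ = _ := by rw [hK]; ring

/-- The entire function `2ξ(s) = s (s - 1) Λ(s)`. -/
def riemannXi (s : ℂ) : ℂ := 1 + s * (s - 1) * completedRiemannZeta₀ s

theorem differentiable_riemannXi : Differentiable ℂ riemannXi := by
  have := differentiable_completedZeta₀
  unfold riemannXi
  fun_prop

theorem riemannXi_zero : riemannXi 0 = 1 := by simp [riemannXi]

theorem riemannXi_eq_zero_of_mem {s : ℂ} (hs : s ∈ zetaZeros) : riemannXi s = 0 := by
  obtain ⟨h, h0, h1⟩ := hs
  have hs0 : s ≠ 0 := by rintro rfl; simp at h0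
  have hs1 : 1 - s ≠ 0 := by
    intro h; rw [← sub_eq_zero.1 h] at h1; simp at h1
  rw [riemannZeta_def_of_ne_zero hs0, div_eq_zero_iff,
    or_iff_left (Gammaℝ_ne_zero_of_re_pos h0), completedRiemannZeta_eq] at h
  rw [riemannXi]
  field_simp at h
  linear_combination -h

theorem exists_log_norm_riemannXi_le : ∃ K : ℝ, 0 < K ∧ ∀ (m : ℕ) (s : ℂ), ‖s‖ ≤ m →
    Real.log ‖riemannXi s‖ ≤ K * ((m + 2) * Real.log (m + 2)) := by
  obtain ⟨C, p, hC, hp, h⟩ := exists_norm_completedRiemannZeta₀_le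
  obtain ⟨a, ha⟩ := exists_nat_ge (1 + 2 * C)
  obtain ⟨b, hb⟩ := exists_nat_ge (max 1 p⁻¹)
  have hb1 : (1 : ℝ) ≤ b := (le_max_left _ _).trans hb
  have hbp : p⁻¹ ≤ b := (le_max_right _ _).trans hb
  refine ⟨a + b + 3, by positivity, fun m s hs => ?_⟩
  have hx2 : (2 : ℝ) ≤ m + 2 := by linarith [(Nat.cast_nonneg m : (0 : ℝ) ≤ m)]
  set x : ℝ := m + 2 with hx
  have hx0 : 0 < x := by linarith
  have hx1 : 1 ≤ x := by linarith
  have hlog : 0 ≤ Real.log x := Real.log_nonneg hx1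
  have hnat : ∀ c : ℕ, (c : ℝ) ≤ x ^ c := fun c => by
    have h1 : (c : ℝ) ≤ 2 ^ c := by exact_mod_cast Nat.lt_two_pow_self.le
    exact h1.trans (by gcongr)
  have h1 := h (m + 1) s (by
    have := Complex.abs_re_le_norm s
    have : (0 : ℝ) ≤ m := Nat.cast_nonneg m
    push_cast; linarith)
  have hbb : (b : ℝ) ^ (m + 1) ≤ b ^ (m + 2) := pow_le_pow_right₀ hb1 (by omega)
  have hf2 : ((m + 2).factorial : ℝ) ≤ x ^ (m + 2) := by
    have := Nat.factorial_le_pow (m + 2)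
    rw [hx]
    exact_mod_cast this
  have hf1 : ((m + 1).factorial : ℝ) ≤ x ^ (m + 2) :=
    le_trans (by exact_mod_cast Nat.factorial_le (by omega)) hf2
  have h2 : ‖completedRiemannZeta₀ s‖ ≤ 2 * C * (x ^ (m + 2) * b ^ (m + 2)) := by
    refine h1.trans ?_
    have e1 : ((m + 1).factorial : ℝ) / p ^ (m + 1) ≤ x ^ (m + 2) * b ^ (m + 2) := by
      rw [div_eq_mul_inv, ← inv_pow]
      refine mul_le_mul hf1 (le_trans ?_ hbb) (by positivity) (by positivity)
      gcongr
    have e2 : ((m + 1 + 1).factorial : ℝ) / p ^ (m + 1 + 1) ≤ x ^ (m + 2) * b ^ (m + 2) := by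
      rw [div_eq_mul_inv, ← inv_pow]
      exact mul_le_mul hf2 (by gcongr) (by positivity) (by positivity)
    calc _ ≤ C * (x ^ (m + 2) * b ^ (m + 2) + x ^ (m + 2) * b ^ (m + 2)) := by gcongr
      _ = _ := by ring
  have h3 : ‖s * (s - 1)‖ ≤ x ^ 2 := by
    rw [norm_mul, sq]
    have : ‖s - 1‖ ≤ ‖s‖ + ‖(1 : ℂ)‖ := norm_sub_le _ _
    rw [norm_one] at this
    refine mul_le_mul (by linarith) (by linarith) (norm_nonneg _) hx0.le
  have h4 : ‖riemannXi s‖ ≤ a * (x ^ 2 * (x ^ (m + 2) * b ^ (m + 2))) := by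
    have hone : 1 ≤ x ^ 2 * (x ^ (m + 2) * (b : ℝ) ^ (m + 2)) :=
      one_le_mul_of_one_le_of_one_le (one_le_pow₀ hx1)
        (one_le_mul_of_one_le_of_one_le (one_le_pow₀ hx1) (one_le_pow₀ hb1))
    calc ‖riemannXi s‖ ≤ ‖(1 : ℂ)‖ + ‖s * (s - 1)‖ * ‖completedRiemannZeta₀ s‖ := by
          rw [riemannXi, ← norm_mul]; exact norm_add_le _ _
      _ ≤ 1 + x ^ 2 * (2 * C * (x ^ (m + 2) * b ^ (m + 2))) := by
          rw [norm_one]; gcongr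
      _ ≤ (1 + 2 * C) * (x ^ 2 * (x ^ (m + 2) * b ^ (m + 2))) := by nlinarith
      _ ≤ _ := by gcongr
  have h5 : ‖riemannXi s‖ ≤ x ^ (a + 2 + (m + 2) + b * (m + 2)) := by
    have e : x ^ (a + 2 + (m + 2) + b * (m + 2)) =
        x ^ a * (x ^ 2 * (x ^ (m + 2) * (x ^ b) ^ (m + 2))) := by
      rw [← pow_mul]; ring
    rw [e]
    refine h4.trans ?_
    gcongr
    exacts [hnat a, hnat b]
  rcases eq_or_ne (riemannXi s) 0 with h0 | h0
  · rw [h0, norm_zero, Real.log_zero]; positivity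
  · refine (Real.log_le_log (norm_pos_iff.2 h0) h5).trans ?_
    rw [Real.log_pow, ← mul_assoc]
    refine mul_le_mul_of_nonneg_right ?_ hlog
    push_cast
    rw [← hx]
    nlinarith [(Nat.cast_nonneg a : (0 : ℝ) ≤ a)]

theorem sum_log_mul_inv_norm_le {f : ℂ → ℂ} (hf : Differentiable ℂ f) (hf0 : f 0 = 1) {R B : ℝ}
    (hR : 0 < R) (hB : ∀ z, ‖z‖ = R → Real.log ‖f z‖ ≤ B) (F : Finset ℂ)
    (hF : ∀ u ∈ F, f u = 0 ∧ ‖u‖ ≤ R) : ∑ u ∈ F, Real.log (R * ‖u‖⁻¹) ≤ B := by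
  have han : AnalyticOnNhd ℂ f (Metric.closedBall 0 |R|) :=
    fun z _ => hf.analyticAt z
  have hJ := han.circleAverage_log_norm hR.ne' (by simp [hf0])
  have hav : Real.circleAverage (fun z => Real.log ‖f z‖) 0 R ≤ B := by
    apply Real.circleAverage_mono_on_of_le_circle
    · exact (han.mono Metric.sphere_subset_closedBall).meromorphicOn.circleIntegrable_log_norm
    · intro z hz
      rw [abs_of_pos hR] at hz
      exact hB z (by simpa using hz)
  simp only [hf0, norm_one, Real.log_one, add_zero, zero_sub, norm_neg] at hJ
  set D := MeromorphicOn.divisor f (Metric.closedBall 0 |R|) with hD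
  have hDfin : Set.Finite (Function.support fun u => (D u : ℝ) * Real.log (R * ‖u‖⁻¹)) := by
    refine (D.finiteSupport (isCompact_closedBall 0 |R|)).subset fun u hu => ?_
    simp only [Function.mem_support] at hu ⊢
    exact fun h => hu (by simp [h])
  have hD0 : 0 ≤ D := MeromorphicOn.AnalyticOnNhd.divisor_nonneg han
  have htop : ∀ u, analyticOrderAt f u ≠ ⊤ := by
    intro u h
    rw [analyticOrderAt_eq_top] at h
    have := (hf.differentiableOn.analyticOnNhd isOpen_univ).eqOn_zero_of_preconnected_of_eventuallyEq_zero
      isPreconnected_univ (Set.mem_univ u) h (Set.mem_univ 0)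
    simp [hf0] at this
  have hlog : ∀ u, D u ≠ 0 → 0 ≤ Real.log (R * ‖u‖⁻¹) := by
    intro u hu
    have hu' : ‖u‖ ≤ R := by
      have := D.supportWithinDomain hu
      rwa [abs_of_pos hR, mem_closedBall_zero_iff] at this
    rcases (norm_nonneg u).eq_or_lt with h | h
    · simp [← h]
    · exact Real.log_nonneg (by rw [← div_eq_mul_inv]; exact (one_le_div h).2 hu')
  have hDF : ∀ u ∈ F, 1 ≤ D u := by
    intro u hu
    have hmem : u ∈ Metric.closedBall (0 : ℂ) |R| := by simpa [abs_of_pos hR] using (hF u hu).2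
    rw [hD, MeromorphicOn.AnalyticOnNhd.divisor_apply han hmem]
    have h0 := ((hf.analyticAt u).analyticOrderAt_ne_zero).2 (hF u hu).1
    obtain ⟨n, hn⟩ := ENat.ne_top_iff_exists.1 (htop u)
    rw [← hn] at h0 ⊢
    have : n ≠ 0 := by exact_mod_cast h0
    simp
    omega
  calc ∑ u ∈ F, Real.log (R * ‖u‖⁻¹)
      ≤ ∑ u ∈ F, (D u : ℝ) * Real.log (R * ‖u‖⁻¹) := by
        refine Finset.sum_le_sum fun u hu => ?_
        have h1 : (1 : ℝ) ≤ D u := by exact_mod_cast hDF u hu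
        exact le_mul_of_one_le_left (hlog u (by have := hDF u hu; omega)) h1
    _ ≤ ∑ u ∈ F ∪ hDfin.toFinset, (D u : ℝ) * Real.log (R * ‖u‖⁻¹) := by
        refine Finset.sum_le_sum_of_subset_of_nonneg Finset.subset_union_left fun u _ _ => ?_
        by_cases h : D u = 0
        · simp [h]
        · exact mul_nonneg (by exact_mod_cast hD0 u) (hlog u h)
    _ = ∑ᶠ u, (D u : ℝ) * Real.log (R * ‖u‖⁻¹) := by
        rw [finsum_eq_sum_of_support_subset]
        intro u hu
        simp only [Finset.coe_union, Set.Finite.coe_toFinset]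
        exact Or.inr hu
    _ ≤ B := hJ ▸ hav

theorem exists_norm_ge_of_mem_zetaZeros : ∃ d : ℝ, 0 < d ∧ ∀ ρ ∈ zetaZeros, d ≤ ‖ρ‖ := by
  have h : ∀ᶠ s in nhds (0 : ℂ), riemannXi s ≠ 0 :=
    differentiable_riemannXi.continuous.continuousAt.eventually_ne (by simp [riemannXi_zero])
  obtain ⟨d, hd, hball⟩ := Metric.eventually_nhds_iff.1 h
  refine ⟨d, hd, fun ρ hρ => ?_⟩
  by_contra! hlt
  exact hball (by simpa using hlt) (riemannXi_eq_zero_of_mem hρ)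

theorem exists_card_zetaZeros_le : ∃ K : ℝ, 0 < K ∧ ∀ (m : ℕ) (F : Finset zetaZeros), 0 < m →
    (∀ ρ ∈ F, ‖(ρ : ℂ)‖ ≤ m) → (F.card : ℝ) ≤ K * ((3 * m + 2) * Real.log (3 * m + 2)) := by
  obtain ⟨K, hK, h⟩ := exists_log_norm_riemannXi_le
  refine ⟨K, hK, fun m F hm hF => ?_⟩
  have hm' : (0 : ℝ) < m := by exact_mod_cast hm
  have hJ := sum_log_mul_inv_norm_le differentiable_riemannXi riemannXi_zero
    (R := (3 * m : ℕ)) (by positivity) (fun z hz => h (3 * m) z hz.le)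
    (F.map (Function.Embedding.subtype _)) (by
      intro u hu
      obtain ⟨ρ, hρ, rfl⟩ := Finset.mem_map.1 hu
      refine ⟨riemannXi_eq_zero_of_mem ρ.2, (hF ρ hρ).trans ?_⟩
      push_cast
      linarith)
  rw [Finset.sum_map] at hJ
  push_cast at hJ
  refine le_trans ?_ hJ
  rw [Finset.card_eq_sum_ones]
  push_cast
  refine Finset.sum_le_sum fun ρ hρ => ?_
  have hρ0 : 0 < ‖(ρ : ℂ)‖ := norm_pos_iff.2 fun h0 => by
    have := ρ.2.2.1
    simp [h0] at this
  simp only [Function.Embedding.subtype_apply]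
  rw [Real.le_log_iff_exp_le (by positivity), ← div_eq_mul_inv, le_div_iff₀ hρ0]
  have := Real.exp_one_lt_d9
  have := hF ρ hρ
  nlinarith

theorem summable_one_add_abs_im_rpow_zetaZeros {e : ℝ} (he : 0 < e) :
    Summable fun ρ : zetaZeros => (1 + |(ρ : ℂ).im|) ^ (-1 - e) := by
  obtain ⟨K, hK, hcard⟩ := exists_card_zetaZeros_le
  have hj : ∀ ρ : zetaZeros, ∃ j : ℕ, (2 : ℝ) ^ j ≤ 4 * (1 + |(ρ : ℂ).im|) ∧ ‖(ρ : ℂ)‖ ≤ 2 ^ j := by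
    intro ρ
    obtain ⟨n, hn1, hn2⟩ := exists_nat_pow_near (x := 1 + ‖(ρ : ℂ)‖)
      (by linarith [norm_nonneg (ρ : ℂ)]) (one_lt_two : (1 : ℝ) < 2)
    refine ⟨n + 1, ?_, by linarith⟩
    have h1 := Complex.norm_le_abs_re_add_abs_im (ρ : ℂ)
    have h2 : |(ρ : ℂ).re| ≤ 1 := abs_le.2 ⟨by linarith [ρ.2.2.1], ρ.2.2.2.le⟩
    rw [pow_succ]
    linarith [abs_nonneg (ρ : ℂ).im]
  choose j hj1 hj2 using hj
  have hterm : ∀ ρ : zetaZeros,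
      (1 + |(ρ : ℂ).im|) ^ (-1 - e) ≤ 4 ^ (1 + e) * ((2 : ℝ) ^ j ρ) ^ (-1 - e) := by
    intro ρ
    have h1 : (0 : ℝ) < 1 + |(ρ : ℂ).im| := by positivity
    have h2 := Real.rpow_le_rpow_of_nonpos (by positivity) (hj1 ρ) (by linarith : -1 - e ≤ 0)
    rw [Real.mul_rpow (by norm_num) h1.le] at h2
    have h3 : (4 : ℝ) ^ (1 + e) * 4 ^ (-1 - e) = 1 := by
      rw [← Real.rpow_add (by norm_num)]; norm_num
    calc _ = 4 ^ (1 + e) * (4 ^ (-1 - e) * (1 + |(ρ : ℂ).im|) ^ (-1 - e)) := by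
          rw [← mul_assoc, h3, one_mul]
      _ ≤ _ := by gcongr
  set M : ℝ := 4 ^ (1 + e) * (K * (5 ^ (1 + e / 2) / (e / 2))) with hM
  have hgeo : Summable fun i : ℕ => M * ((2 : ℝ) ^ (-(e / 2))) ^ i :=
    (summable_geometric_of_lt_one (by positivity)
      (Real.rpow_lt_one_of_one_lt_of_neg one_lt_two (by linarith))).mul_left _
  refine summable_of_sum_le (c := ∑' i : ℕ, M * ((2 : ℝ) ^ (-(e / 2))) ^ i)
    (fun ρ => by positivity) fun F => ?_
  have hfib : ∀ i : ℕ, ∑ ρ ∈ F with j ρ = i, (1 + |(ρ : ℂ).im|) ^ (-1 - e) ≤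
      M * ((2 : ℝ) ^ (-(e / 2))) ^ i := by
    intro i
    have hc := hcard (2 ^ i) {ρ ∈ F | j ρ = i} (by positivity) (by
      intro ρ hρ
      have := hj2 ρ
      rw [(Finset.mem_filter.1 hρ).2] at this
      exact_mod_cast this)
    push_cast at hc
    set x : ℝ := 2 ^ i with hx
    have hx1 : 1 ≤ x := one_le_pow₀ one_le_two
    have hx0 : 0 < x := by linarith
    have hlog : (3 * x + 2) * Real.log (3 * x + 2) ≤ 5 ^ (1 + e / 2) / (e / 2) * x ^ (1 + e / 2) := by
      have h1 := Real.log_le_rpow_div (by positivity : 0 ≤ 3 * x + 2) (half_pos he)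
      calc (3 * x + 2) * Real.log (3 * x + 2)
          ≤ (3 * x + 2) * ((3 * x + 2) ^ (e / 2) / (e / 2)) := by gcongr
        _ = (3 * x + 2) ^ (1 + e / 2) / (e / 2) := by
            rw [Real.rpow_add (by positivity), Real.rpow_one]; ring
        _ ≤ (5 * x) ^ (1 + e / 2) / (e / 2) := by gcongr; linarith
        _ = _ := by rw [Real.mul_rpow (by norm_num) hx0.le]; ring
    calc ∑ ρ ∈ F with j ρ = i, (1 + |(ρ : ℂ).im|) ^ (-1 - e)
        ≤ ∑ ρ ∈ F with j ρ = i, 4 ^ (1 + e) * x ^ (-1 - e) := by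
          refine Finset.sum_le_sum fun ρ hρ => ?_
          have := hterm ρ
          rwa [(Finset.mem_filter.1 hρ).2] at this
      _ = ({ρ ∈ F | j ρ = i}.card : ℝ) * (4 ^ (1 + e) * x ^ (-1 - e)) := by
          rw [Finset.sum_const, nsmul_eq_mul]
      _ ≤ (K * (5 ^ (1 + e / 2) / (e / 2) * x ^ (1 + e / 2))) * (4 ^ (1 + e) * x ^ (-1 - e)) := by
          gcongr
          exact hc.trans (by gcongr)
      _ = M * (x ^ (1 + e / 2) * x ^ (-1 - e)) := by rw [hM]; ring
      _ = _ := by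
          rw [← Real.rpow_add hx0, hx, ← Real.rpow_natCast, ← Real.rpow_natCast,
            ← Real.rpow_mul zero_le_two, ← Real.rpow_mul zero_le_two]
          congr 2
          ring
  calc ∑ ρ ∈ F, (1 + |(ρ : ℂ).im|) ^ (-1 - e)
      = ∑ i ∈ F.image j, ∑ ρ ∈ F with j ρ = i, (1 + |(ρ : ℂ).im|) ^ (-1 - e) :=
        (Finset.sum_fiberwise_of_maps_to (fun ρ hρ => Finset.mem_image_of_mem j hρ) _).symm
    _ ≤ ∑ i ∈ F.image j, M * ((2 : ℝ) ^ (-(e / 2))) ^ i := Finset.sum_le_sum fun i _ => hfib i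
    _ ≤ _ := hgeo.sum_le_tsum _ fun i _ => by positivity

theorem countable_zetaZeros : Countable zetaZeros := by
  have h := (summable_one_add_abs_im_rpow_zetaZeros one_pos).countable_support
  rw [Function.support_eq_univ (fun ρ => by positivity)] at h
  exact Set.countable_univ_iff.1 h

theorem norm_cpow_sub_one_mul_exp {s r : ℂ} {t : ℝ} (ht : 0 < t) :
    ‖(t : ℂ) ^ (s - 1) * Complex.exp (-(r * t))‖ = t ^ (s.re - 1) * Real.exp (-r.re * t) := by
  rw [norm_mul, Complex.norm_cpow_eq_rpow_re_of_pos ht, Complex.norm_exp]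
  simp

theorem integrableOn_rpow_mul_exp_neg_mul {p b : ℝ} (hp : -1 < p) (hb : 0 < b) :
    MeasureTheory.IntegrableOn (fun t : ℝ => t ^ p * Real.exp (-b * t)) (Set.Ioi 0) := by
  simpa using integrableOn_rpow_mul_exp_neg_mul_rpow hp one_pos hb

theorem continuousOn_cpow_mul_exp (s r : ℂ) :
    ContinuousOn (fun t : ℝ => (t : ℂ) ^ s * Complex.exp (-(r * t))) (Set.Ioi 0) := by
  refine ContinuousOn.mul (ContinuousOn.cpow_const (by fun_prop) fun t ht => ?_) (by fun_prop)
  exact Or.inl ht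

theorem integrableOn_cpow_mul_exp_neg_mul {s r : ℂ} (hs : 0 < s.re) (hr : 0 < r.re) :
    MeasureTheory.IntegrableOn (fun t : ℝ => (t : ℂ) ^ (s - 1) * Complex.exp (-(r * t)))
      (Set.Ioi 0) := by
  refine (integrableOn_rpow_mul_exp_neg_mul (by linarith : -1 < s.re - 1) hr).mono'
    ((continuousOn_cpow_mul_exp _ _).aestronglyMeasurable measurableSet_Ioi) ?_
  exact (MeasureTheory.ae_restrict_iff' measurableSet_Ioi).2
    (Filter.Eventually.of_forall fun t ht => (norm_cpow_sub_one_mul_exp ht).le)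

theorem differentiableOn_integral_cpow_mul_exp {s : ℂ} (hs : 0 < s.re) :
    DifferentiableOn ℂ (fun r : ℂ => ∫ t in Set.Ioi (0 : ℝ),
      (t : ℂ) ^ (s - 1) * Complex.exp (-(r * t))) {r | 0 < r.re} := by
  intro r (hr : 0 < r.re)
  have hopen : {z : ℂ | r.re / 2 < z.re} ∈ nhds r :=
    (isOpen_lt continuous_const Complex.continuous_re).mem_nhds (by simpa using hr)
  refine DifferentiableAt.differentiableWithinAt (HasDerivAt.differentiableAt
    (hasDerivAt_integral_of_dominated_loc_of_deriv_le (𝕜 := ℂ)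
    (F := fun r t => (t : ℂ) ^ (s - 1) * Complex.exp (-(r * t)))
    (F' := fun r t => (t : ℂ) ^ (s - 1) * (Complex.exp (-(r * t)) * -t))
    (bound := fun t => t ^ s.re * Real.exp (-(r.re / 2) * t)) hopen
    (Filter.Eventually.of_forall fun z =>
      (continuousOn_cpow_mul_exp _ _).aestronglyMeasurable measurableSet_Ioi)
    (integrableOn_cpow_mul_exp_neg_mul hs hr) ?_ ?_
    (integrableOn_rpow_mul_exp_neg_mul (by linarith) (half_pos hr)) ?_).2)
  · refine ContinuousOn.aestronglyMeasurable ?_ measurableSet_Ioi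
    simp only [← mul_assoc]
    exact (continuousOn_cpow_mul_exp _ _).mul (by fun_prop)
  · refine (MeasureTheory.ae_restrict_iff' measurableSet_Ioi).2
      (Filter.Eventually.of_forall fun t (ht : 0 < t) z (hz : r.re / 2 < z.re) => ?_)
    rw [← mul_assoc, norm_mul, norm_cpow_sub_one_mul_exp ht, norm_neg, Complex.norm_real,
      Real.norm_of_nonneg ht.le, mul_right_comm, Real.rpow_sub_one ht.ne', div_mul_cancel₀ _ ht.ne']
    gcongr
  · refine Filter.Eventually.of_forall fun t z _ => ?_
    have h : HasDerivAt (fun z : ℂ => -(z * t)) (-(1 * (t : ℂ))) z :=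
      ((hasDerivAt_id z).mul_const _).neg
    rw [one_mul] at h
    exact h.cexp.const_mul _

theorem integral_cpow_mul_exp_neg_mul_Ioi_of_re_pos {s r : ℂ} (hs : 0 < s.re) (hr : 0 < r.re) :
    ∫ t in Set.Ioi (0 : ℝ), (t : ℂ) ^ (s - 1) * Complex.exp (-(r * t)) =
      Complex.Gamma s * r ^ (-s) := by
  have hopen : IsOpen {z : ℂ | 0 < z.re} := isOpen_lt continuous_const Complex.continuous_re
  have hconv : Convex ℝ {z : ℂ | 0 < z.re} := convex_halfSpace_re_gt 0
  have hd : DifferentiableOn ℂ (fun r : ℂ => Complex.Gamma s * r ^ (-s)) {r | 0 < r.re} := by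
    intro z (hz : 0 < z.re)
    exact ((differentiableAt_id.cpow_const (Or.inl hz)).const_mul _).differentiableWithinAt
  refine ((differentiableOn_integral_cpow_mul_exp hs).analyticOnNhd
    hopen).eqOn_of_preconnected_of_frequently_eq (z₀ := 1) (hd.analyticOnNhd hopen)
    hconv.isPreconnected (by simp) ?_ hr
  have ht : Filter.Tendsto (fun n : ℕ => ((1 + 1 / ((n : ℝ) + 1) : ℝ) : ℂ)) Filter.atTop
      (nhdsWithin 1 {1}ᶜ) := by
    refine tendsto_nhdsWithin_iff.2 ⟨?_, Filter.Eventually.of_forall fun n => ?_⟩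
    · have h := (tendsto_one_div_add_atTop_nhds_zero_nat (𝕜 := ℝ)).const_add 1
      rw [add_zero] at h
      exact (Complex.continuous_ofReal.tendsto' 1 1 (by simp)).comp h
    · have : (0 : ℝ) < 1 / ((n : ℝ) + 1) := by positivity
      simp only [Set.mem_compl_iff, Set.mem_singleton_iff, Complex.ofReal_eq_one]
      linarith
  refine ht.frequently (Filter.Frequently.of_forall fun n => ?_)
  have hx : (0 : ℝ) < 1 + 1 / ((n : ℝ) + 1) := by positivity
  rw [Complex.integral_cpow_mul_exp_neg_mul_Ioi hs hx, one_div, Complex.inv_cpow,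
    ← Complex.cpow_neg, mul_comm]
  rw [Complex.arg_ofReal_of_nonneg hx.le]
  exact Real.pi_ne_zero.symm

theorem integrable_norm_add_mul_I_rpow {c r : ℝ} (hc : 0 < c) (hr : 1 < r) :
    MeasureTheory.Integrable fun y : ℝ => ‖(c : ℂ) + y * I‖ ^ (-r) := by
  have h := (integrable_rpow_neg_one_add_norm_sq (E := ℝ) (μ := MeasureTheory.volume) (r := r)
    (by simpa using hr)).const_mul ((min 1 (c ^ 2)) ^ (-r / 2))
  have hne : ∀ y : ℝ, 0 < ‖(c : ℂ) + y * I‖ := fun y => norm_pos_iff.2 fun h0 => by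
    have := congrArg Complex.re h0
    simp at this
    exact hc.ne' this
  refine h.mono' (Continuous.aestronglyMeasurable ?_) (Filter.Eventually.of_forall fun y => ?_)
  · exact Continuous.rpow_const (by fun_prop) fun y => Or.inl (hne y).ne'
  · have hm : 0 < min 1 (c ^ 2) := by positivity
    rw [Real.norm_of_nonneg (by positivity), ← Real.mul_rpow hm.le (by positivity)]
    have hsq : ‖(c : ℂ) + y * I‖ ^ 2 = c ^ 2 + y ^ 2 := by
      rw [← Complex.normSq_eq_norm_sq, Complex.normSq_add_mul_I]
    have e : ‖(c : ℂ) + y * I‖ ^ (-r) = (‖(c : ℂ) + y * I‖ ^ 2) ^ (-r / 2) := by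
      rw [← Real.rpow_natCast, ← Real.rpow_mul (norm_nonneg _)]
      congr 1
      push_cast; ring
    rw [e, hsq, Real.norm_eq_abs, sq_abs]
    refine Real.rpow_le_rpow_of_nonpos (by positivity) ?_ (by linarith)
    nlinarith [min_le_left 1 (c ^ 2), min_le_right 1 (c ^ 2), sq_nonneg y]

theorem integrable_add_mul_I_cpow {c : ℝ} {s : ℂ} (hc : 0 < c) (hs : 1 < s.re) :
    MeasureTheory.Integrable fun y : ℝ => ((c : ℂ) + y * I) ^ (-s) := by
  refine ((integrable_norm_add_mul_I_rpow hc hs).mul_const (Real.exp (Real.pi * |s.im|))).mono'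
    (Continuous.aestronglyMeasurable ?_) (Filter.Eventually.of_forall fun y => ?_)
  · refine Continuous.cpow (by fun_prop) (by fun_prop) fun y => Or.inl ?_
    simpa using hc
  · refine (Complex.norm_cpow_le _ _).trans ?_
    rw [div_eq_mul_inv, ← Real.exp_neg, Complex.neg_re, Complex.neg_im]
    gcongr
    rw [mul_neg, neg_neg]
    refine (le_abs_self _).trans ?_
    rw [abs_mul]
    gcongr
    exact Complex.abs_arg_le_pi _

theorem Gamma_mul_integral_exp_mul_cpow {c N : ℝ} {s : ℂ} (hc : 0 < c) (hN : 0 < N)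
    (hs : 1 < s.re) :
    Complex.Gamma s * ∫ y : ℝ, Complex.exp (N * (c + y * I)) * ((c : ℂ) + y * I) ^ (-s) =
      2 * Real.pi * (N : ℂ) ^ (s - 1) := by
  have hs0 : 0 < s.re := by linarith
  set f : ℝ → ℂ := (Set.Ioi (0 : ℝ)).indicator
    fun t => (t : ℂ) ^ (s - 1) * Complex.exp (-(c * t)) with hf
  have hfi : MeasureTheory.Integrable f :=
    (MeasureTheory.integrable_indicator_iff measurableSet_Ioi).2
      (integrableOn_cpow_mul_exp_neg_mul hs0 (by simpa using hc))
  have hF : FourierTransform.fourier f =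
      fun w : ℝ => Complex.Gamma s * ((c : ℂ) + ((2 * Real.pi * w : ℝ) : ℂ) * I) ^ (-s) := by
    ext w
    rw [Real.fourier_real_eq_integral_exp_smul, ← integral_cpow_mul_exp_neg_mul_Ioi_of_re_pos hs0
      (by simpa using hc), ← MeasureTheory.integral_indicator measurableSet_Ioi]
    refine MeasureTheory.integral_congr_ae (Filter.Eventually.of_forall fun t => ?_)
    simp only [hf, Set.indicator_apply, smul_eq_mul]
    split_ifs
    · rw [mul_left_comm, ← Complex.exp_add]
      congr 2
      push_cast
      ring
    · simp
  have hFi : MeasureTheory.Integrable (FourierTransform.fourier f) := by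
    rw [hF]
    exact ((integrable_add_mul_I_cpow hc hs).comp_mul_left'
      (by positivity : 2 * Real.pi ≠ 0)).const_mul _
  have hcont : ContinuousAt f N := by
    refine ((continuousOn_cpow_mul_exp (s - 1) c).continuousAt (Ioi_mem_nhds hN)).congr
      (?_ : _ =ᶠ[nhds N] f)
    filter_upwards [Ioi_mem_nhds hN] with t ht
    rw [hf, Set.indicator_of_mem ht]
  have hinv := hfi.fourierInv_fourier_eq hFi hcont
  rw [hF, Real.fourierInv_eq', hf, Set.indicator_of_mem (Set.mem_Ioi.2 hN)] at hinv
  set g : ℝ → ℂ := fun y => Complex.exp (y * N * I) * ((c : ℂ) + y * I) ^ (-s) with hg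
  have h1 : Complex.Gamma s * ((2 * Real.pi : ℝ)⁻¹ * ∫ y, g y) =
      (N : ℂ) ^ (s - 1) * Complex.exp (-(c * N)) := by
    rw [← hinv]
    have h2 := MeasureTheory.Measure.integral_comp_mul_left g (2 * Real.pi)
    rw [abs_of_pos (by positivity), Complex.real_smul] at h2
    rw [← h2, ← MeasureTheory.integral_const_mul]
    refine MeasureTheory.integral_congr_ae (Filter.Eventually.of_forall fun t => ?_)
    simp only [hg, smul_eq_mul]
    rw [mul_left_comm]
    congr 2
    simp
    ring
  have h3 : ∫ y : ℝ, Complex.exp (N * (c + y * I)) * ((c : ℂ) + y * I) ^ (-s) =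
      Complex.exp (c * N) * ∫ y, g y := by
    rw [← MeasureTheory.integral_const_mul]
    refine MeasureTheory.integral_congr_ae (Filter.Eventually.of_forall fun t => ?_)
    simp only [hg]
    rw [← mul_assoc, ← Complex.exp_add]
    congr 2
    ring
  have hpi : (Real.pi : ℂ) ≠ 0 := by exact_mod_cast Real.pi_ne_zero
  have h4 : Complex.exp (c * N) * Complex.exp (-(c * N)) = 1 := by
    rw [← Complex.exp_add]; simp
  rw [h3]
  push_cast at h1
  field_simp at h1
  linear_combination Complex.exp (c * N) * h1 + 2 * Real.pi * (N : ℂ) ^ (s - 1) * h4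

theorem integral_mul_tsum_mul_tsum {ι : Type*} [Countable ι] {h : ℝ → ℂ} {a b : ι → ℝ → ℂ}
    {g : ι → ℝ} {u w : ℝ → ℝ} (hg0 : ∀ i, 0 ≤ g i) (hg : Summable g)
    (hw : MeasureTheory.Integrable w) (hh : Continuous h) (ha : ∀ i, Continuous (a i))
    (hb : ∀ i, Continuous (b i)) (hu : ∀ y, 0 ≤ u y) (hau : ∀ i y, ‖a i y‖ ≤ g i * u y)
    (hbu : ∀ i y, ‖b i y‖ ≤ g i * u y) (hhw : ∀ y, ‖h y‖ * u y * u y ≤ w y) :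
    Summable (fun p : ι × ι => ∫ y, ‖h y * a p.1 y * b p.2 y‖) ∧
      ∫ y, h y * (∑' i, a i y) * (∑' i, b i y) = ∑' p : ι × ι, ∫ y, h y * a p.1 y * b p.2 y := by
  have hbound : ∀ (p : ι × ι) (y : ℝ), ‖h y * a p.1 y * b p.2 y‖ ≤ g p.1 * g p.2 * w y := by
    intro p y
    rw [norm_mul, norm_mul]
    have := hg0 p.1
    have := hg0 p.2
    have := hu y
    calc ‖h y‖ * ‖a p.1 y‖ * ‖b p.2 y‖ ≤ ‖h y‖ * (g p.1 * u y) * (g p.2 * u y) := by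
          gcongr
          exacts [hau _ _, hbu _ _]
      _ = g p.1 * g p.2 * (‖h y‖ * u y * u y) := by ring
      _ ≤ _ := by gcongr; exact hhw y
  have hint : ∀ p : ι × ι, MeasureTheory.Integrable fun y => h y * a p.1 y * b p.2 y := fun p =>
    (hw.const_mul _).mono' ((hh.mul (ha p.1)).mul (hb p.2)).aestronglyMeasurable
      (Filter.Eventually.of_forall (hbound p))
  have hsum : Summable (fun p : ι × ι => ∫ y, ‖h y * a p.1 y * b p.2 y‖) := by
    refine Summable.of_nonneg_of_le (fun p => MeasureTheory.integral_nonneg fun y => norm_nonneg _)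
      (fun p => ?_) ((hg.mul_of_nonneg hg hg0 hg0).mul_right (∫ y, w y))
    rw [← MeasureTheory.integral_const_mul]
    exact MeasureTheory.integral_mono (hint p).norm (hw.const_mul _) (hbound p)
  refine ⟨hsum, ?_⟩
  rw [← (MeasureTheory.hasSum_integral_of_summable_integral_norm hint hsum).tsum_eq.symm]
  refine MeasureTheory.integral_congr_ae (Filter.Eventually.of_forall fun y => ?_)
  have hsa : Summable fun i => ‖a i y‖ :=
    Summable.of_nonneg_of_le (fun i => norm_nonneg _) (fun i => hau i y) (hg.mul_right _)
  have hsb : Summable fun i => ‖b i y‖ :=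
    Summable.of_nonneg_of_le (fun i => norm_nonneg _) (fun i => hbu i y) (hg.mul_right _)
  simp only [mul_assoc]
  rw [tsum_mul_left, tsum_mul_tsum_of_summable_norm hsa hsb]

theorem exists_norm_cpow_mul_Gamma_zetaZeros_le {c e : ℝ} (hc : 0 < c) (he : 0 < e) :
    ∃ C : ℝ, 0 < C ∧ ∀ (ρ : zetaZeros) (z : ℂ), z.re = c →
      ‖z ^ (-(ρ : ℂ)) * Complex.Gamma ρ‖ ≤
        C * (1 + |(ρ : ℂ).im|) ^ (-1 - e) * ‖z‖ ^ (1 / 2 + e) ∧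
      ‖z ^ (-(ρ : ℂ) / 2) * Complex.Gamma (ρ / 2)‖ ≤
        C * (1 + |(ρ : ℂ).im|) ^ (-1 - e) * ‖z‖ ^ (1 / 2 + e) := by
  obtain ⟨d, hd, hdρ⟩ := exists_norm_ge_of_mem_zetaZeros
  obtain ⟨C, hC, h⟩ := exists_norm_cpow_mul_Gamma_le hc (half_pos hd) he
  have h2 : (1 : ℝ) ≤ 2 ^ (1 + e) := Real.one_le_rpow one_le_two (by linarith)
  refine ⟨C * 2 ^ (1 + e), by positivity, fun ρ z hz => ⟨?_, ?_⟩⟩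
  · refine (h ρ ρ.2.2.1 ρ.2.2.2 (by linarith [hdρ ρ ρ.2]) z hz).trans ?_
    gcongr
    exact le_mul_of_one_le_right hC.le h2
  · have hre : ((ρ : ℂ) / 2).re = (ρ : ℂ).re / 2 := by simp
    have him : ((ρ : ℂ) / 2).im = (ρ : ℂ).im / 2 := by simp
    have hρ := ρ.2.2
    have h3 := h (ρ / 2) (by rw [hre]; linarith) (by rw [hre]; linarith)
      (by rw [norm_div, Complex.norm_ofNat]; linarith [hdρ ρ ρ.2]) z hz
    rw [neg_div]
    refine h3.trans ?_
    rw [mul_assoc C (2 ^ (1 + e)), him]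
    gcongr
    have h4 : (0 : ℝ) < 1 + |(ρ : ℂ).im| := by positivity
    calc (1 + |(ρ : ℂ).im / 2|) ^ (-1 - e) ≤ (2⁻¹ * (1 + |(ρ : ℂ).im|)) ^ (-1 - e) := by
          refine Real.rpow_le_rpow_of_nonpos (by positivity) ?_ (by linarith)
          rw [abs_div, abs_two]
          linarith
      _ = _ := by
          rw [Real.mul_rpow (by norm_num) h4.le, Real.inv_rpow zero_le_two,
            ← Real.rpow_neg zero_le_two]
          congr 2
          ring

/-- Evaluation of `I₄`: the double series over zeros can be exchanged with the integral, and
`(1/(4√π i)) ∫_{(1/N)} e^{Nz} z^{-k-3/2} (∑_{ρ₁} z^{-ρ₁} Γ(ρ₁)) (∑_{ρ₂} z^{-ρ₂/2} Γ(ρ₂/2)) dz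
  = (N^{k+1/2} √π / 2) ∑_{ρ₁}∑_{ρ₂} N^{ρ₁+ρ₂/2} Γ(ρ₁)Γ(ρ₂/2)/Γ(k+3/2+ρ₁+ρ₂/2)`. -/
theorem I4_evaluation (N : ℕ) (hN : 1 < N) (k : ℝ) (hk : 1 / 2 < k) :
    Summable (fun p : zetaZeros × zetaZeros =>
      ∫ y : ℝ,
        ‖Complex.exp ((N : ℂ) * ((1 / (N : ℂ)) + y * Complex.I)) *
            ((1 / (N : ℂ)) + y * Complex.I) ^ (-(k : ℂ) - 3 / 2) *
              ((1 / (N : ℂ)) + y * Complex.I) ^ (-(p.1 : ℂ)) * Complex.Gamma (p.1 : ℂ) *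
                (((1 / (N : ℂ)) + y * Complex.I) ^ (-(p.2 : ℂ) / 2) *
                  Complex.Gamma ((p.2 : ℂ) / 2))‖) ∧
    (1 / (4 * (Real.sqrt Real.pi : ℂ) * Complex.I)) *
        (∫ y : ℝ,
          Complex.exp ((N : ℂ) * ((1 / (N : ℂ)) + y * Complex.I)) *
            ((1 / (N : ℂ)) + y * Complex.I) ^ (-(k : ℂ) - 3 / 2) *
              (∑' ρ : zetaZeros,
                ((1 / (N : ℂ)) + y * Complex.I) ^ (-(ρ : ℂ)) * Complex.Gamma (ρ : ℂ)) *
                (∑' ρ : zetaZeros,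
                  ((1 / (N : ℂ)) + y * Complex.I) ^ (-(ρ : ℂ) / 2) *
                    Complex.Gamma ((ρ : ℂ) / 2)) *
                Complex.I)
      = (N : ℂ) ^ ((k : ℂ) + 1 / 2) * (Real.sqrt Real.pi : ℂ) / 2 *
          ∑' p : zetaZeros × zetaZeros,
            (N : ℂ) ^ ((p.1 : ℂ) + (p.2 : ℂ) / 2) * Complex.Gamma (p.1 : ℂ) *
              Complex.Gamma ((p.2 : ℂ) / 2) /
                Complex.Gamma ((k : ℂ) + 3 / 2 + (p.1 : ℂ) + (p.2 : ℂ) / 2) := by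
  have hN0 : (0 : ℝ) < N := by exact_mod_cast (by omega : 0 < N)
  have hNC : (N : ℂ) ≠ 0 := by exact_mod_cast hN0.ne'
  obtain ⟨c, hc⟩ : ∃ c : ℝ, c = 1 / (N : ℝ) := ⟨_, rfl⟩
  have hc0 : 0 < c := by rw [hc]; positivity
  have hcast : (1 / (N : ℂ)) = (c : ℂ) := by rw [hc]; push_cast; rfl
  have hNc : (N : ℝ) * c = 1 := by rw [hc]; field_simp
  simp only [hcast]
  have hslit : ∀ y : ℝ, (c : ℂ) + y * I ∈ slitPlane := fun y => Or.inl (by simpa using hc0)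
  obtain ⟨e, he⟩ : ∃ e : ℝ, e = (k - 1 / 2) / 4 := ⟨_, rfl⟩
  have he0 : 0 < e := by rw [he]; linarith
  obtain ⟨C, hC, hb⟩ := exists_norm_cpow_mul_Gamma_zetaZeros_le hc0 he0
  have hcount := countable_zetaZeros
  have hcont : ∀ w : ℂ, Continuous fun y : ℝ => ((c : ℂ) + y * I) ^ w := fun w =>
    Continuous.cpow (by fun_prop) (by fun_prop) hslit
  have hr : 1 < k + 1 / 2 - 2 * e := by rw [he]; linarith
  obtain ⟨hsum, hint⟩ := integral_mul_tsum_mul_tsum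
    (h := fun y : ℝ => Complex.exp ((N : ℂ) * ((c : ℂ) + y * I)) *
      ((c : ℂ) + y * I) ^ (-(k : ℂ) - 3 / 2))
    (a := fun (ρ : zetaZeros) y => ((c : ℂ) + y * I) ^ (-(ρ : ℂ)) * Complex.Gamma ρ)
    (b := fun (ρ : zetaZeros) y => ((c : ℂ) + y * I) ^ (-(ρ : ℂ) / 2) * Complex.Gamma (ρ / 2))
    (g := fun ρ : zetaZeros => C * (1 + |(ρ : ℂ).im|) ^ (-1 - e))
    (u := fun y => ‖(c : ℂ) + y * I‖ ^ (1 / 2 + e))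
    (w := fun y => Real.exp 1 * ‖(c : ℂ) + y * I‖ ^ (-(k + 1 / 2 - 2 * e)))
    (fun ρ => by positivity) ((summable_one_add_abs_im_rpow_zetaZeros he0).mul_left C)
    ((integrable_norm_add_mul_I_rpow hc0 hr).const_mul _)
    ((by fun_prop : Continuous _).mul (hcont _)) (fun ρ => (hcont _).mul continuous_const)
    (fun ρ => (hcont _).mul continuous_const) (fun y => by positivity)
    (fun ρ y => (hb ρ _ (by simp)).1) (fun ρ y => (hb ρ _ (by simp)).2)
    (fun y => by
      have hz : 0 < ‖(c : ℂ) + y * I‖ := norm_pos_iff.2 (slitPlane_ne_zero (hslit y))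
      have hw : -(k : ℂ) - 3 / 2 = ((-k - 3 / 2 : ℝ) : ℂ) := by push_cast; rfl
      have hre : ((N : ℂ) * ((c : ℂ) + y * I)).re = 1 := by simp [hNc]
      rw [norm_mul, Complex.norm_exp, hre, hw, Complex.norm_cpow_real, mul_assoc, mul_assoc,
        ← Real.rpow_add hz, ← Real.rpow_add hz]
      refine le_of_eq ?_
      congr 2
      ring)
  refine ⟨by simpa only [mul_assoc] using hsum, ?_⟩
  rw [MeasureTheory.integral_mul_const, hint, ← tsum_mul_right, ← tsum_mul_left, ← tsum_mul_left]
  refine tsum_congr fun p => ?_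
  obtain ⟨s, hs⟩ : ∃ s : ℂ, s = (k : ℂ) + 3 / 2 + p.1 + p.2 / 2 := ⟨_, rfl⟩
  have hsre : 1 < s.re := by
    have h1 := p.1.2.2.1
    have h2 := p.2.2.2.1
    have : s.re = k + 3 / 2 + (p.1 : ℂ).re + (p.2 : ℂ).re / 2 := by simp [hs]
    linarith
  have hG := Gamma_mul_integral_exp_mul_cpow hc0 hN0 hsre
  have hG0 : Complex.Gamma s ≠ 0 := Complex.Gamma_ne_zero_of_re_pos (by linarith)
  have hterm : ∫ y : ℝ, Complex.exp ((N : ℂ) * ((c : ℂ) + y * I)) *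
      ((c : ℂ) + y * I) ^ (-(k : ℂ) - 3 / 2) *
        (((c : ℂ) + y * I) ^ (-(p.1 : ℂ)) * Complex.Gamma p.1) *
        (((c : ℂ) + y * I) ^ (-(p.2 : ℂ) / 2) * Complex.Gamma (p.2 / 2)) =
      (∫ y : ℝ, Complex.exp ((N : ℝ) * ((c : ℂ) + y * I)) * ((c : ℂ) + y * I) ^ (-s)) *
        (Complex.Gamma p.1 * Complex.Gamma (p.2 / 2)) := by
    rw [← MeasureTheory.integral_mul_const]
    refine MeasureTheory.integral_congr_ae (Filter.Eventually.of_forall fun y => ?_)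
    have hz := slitPlane_ne_zero (hslit y)
    have e1 : -s = (-(k : ℂ) - 3 / 2) + -(p.1 : ℂ) + -(p.2 : ℂ) / 2 := by rw [hs]; ring
    simp only [e1, Complex.cpow_add _ _ hz, Complex.ofReal_natCast]
    ring
  have e2 : ((N : ℝ) : ℂ) ^ (s - 1) = (N : ℂ) ^ ((k : ℂ) + 1 / 2) *
      (N : ℂ) ^ ((p.1 : ℂ) + (p.2 : ℂ) / 2) := by
    rw [← Complex.cpow_add _ _ hNC, hs, Complex.ofReal_natCast]
    congr 1
    ring
  have hpi : (Real.sqrt Real.pi : ℂ) * Real.sqrt Real.pi = Real.pi := by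
    exact_mod_cast Real.mul_self_sqrt Real.pi_pos.le
  have hsq : (Real.sqrt Real.pi : ℂ) ≠ 0 := by
    exact_mod_cast (Real.sqrt_pos.2 Real.pi_pos).ne'
  rw [hterm, ← hs]
  rw [e2, ← hpi] at hG
  generalize (∫ y : ℝ, Complex.exp ((N : ℝ) * ((c : ℂ) + y * I)) * ((c : ℂ) + y * I) ^ (-s)) = J
    at hG ⊢
  generalize (N : ℂ) ^ ((k : ℂ) + 1 / 2) = X at hG ⊢
  generalize (N : ℂ) ^ ((p.1 : ℂ) + (p.2 : ℂ) / 2) = Y at hG ⊢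
  field_simp
  linear_combination 2 * Complex.Gamma p.1 * Complex.Gamma (p.2 / 2) * hG

end
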